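/- arXiv:1709.02423 — 5 statements merged into one kernel-verified Lean document; each statement's English description precedes it below -/
import Mathlib

section
/- Let the feasible semidefinite system (P_SD) satisfy the assumption that Z = diag(I_r, 0) is a maximum rank slack. If Good condition 1 fails or Good condition 2 fails, then the Bad condition holds: there exists a linear combination V = Σ λ_i A_i with blocks V = [[V_11, V_12],[V_12ᵀ, V_22]] such that V_22 is positive semidefinite and the column space of V_12ᵀ is not contained in the column space of V_22. -/
open Matrix

/-- Trace inner product `S • T = trace(ST)` of square real matrices. -/
noncomputable def ip {k : ℕ} (S T : Matrix (Fin k) (Fin k) ℝ) : ℝ :=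
  Matrix.trace (S * T)

/-- `x` is feasible for the semidefinite system `∑ xᵢ Aᵢ ⪯ B`. -/
def IsFeasible {n m : ℕ} (A : Fin m → Matrix (Fin n) (Fin n) ℝ)
    (B : Matrix (Fin n) (Fin n) ℝ) (x : Fin m → ℝ) : Prop :=
  (B - ∑ i, x i • A i).PosSemidef

/-- The set of primal objective values `∑ cᵢ xᵢ` over feasible `x`. -/
def PrimalVals {n m : ℕ} (A : Fin m → Matrix (Fin n) (Fin n) ℝ)
    (B : Matrix (Fin n) (Fin n) ℝ) (c : Fin m → ℝ) : Set ℝ :=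
  {s | ∃ x : Fin m → ℝ, IsFeasible A B x ∧ s = ∑ i, c i * x i}

/-- The system `∑ xᵢ Aᵢ ⪯ B` is badly behaved: for some `c` the primal optimal
value is finite (i.e. is a least upper bound `v`), but no dual feasible `Y`
achieves value `v`. -/
def BadlyBehaved {n m : ℕ} (A : Fin m → Matrix (Fin n) (Fin n) ℝ)
    (B : Matrix (Fin n) (Fin n) ℝ) : Prop :=
  ∃ (c : Fin m → ℝ) (v : ℝ), IsLUB (PrimalVals A B c) v ∧
    ¬ ∃ Y : Matrix (Fin n) (Fin n) ℝ,
        Y.PosSemidef ∧ (∀ i, ip (A i) Y = c i) ∧ ip B Y = v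

/-- `Zmat n r = diag(I_r, 0)`. -/
def Zmat (n r : ℕ) : Matrix (Fin n) (Fin n) ℝ :=
  Matrix.of fun i j => if i = j ∧ (i : ℕ) < r then (1 : ℝ) else 0

/-- `Zmat n r` is a maximum rank slack of `∑ xᵢ Aᵢ ⪯ B`:
it is a slack and every slack has rank at most `r`. -/
def MaxRankSlack {n m : ℕ} (A : Fin m → Matrix (Fin n) (Fin n) ℝ)
    (B : Matrix (Fin n) (Fin n) ℝ) (r : ℕ) : Prop :=
  (∃ x : Fin m → ℝ, B - ∑ i, x i • A i = Zmat n r) ∧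
  ∀ x : Fin m → ℝ, IsFeasible A B x → (B - ∑ i, x i • A i).rank ≤ r

/-- Lower-right `(n-r) × (n-r)` block. -/
def block22 {n : ℕ} (r : ℕ) (h : r ≤ n) (V : Matrix (Fin n) (Fin n) ℝ) :
    Matrix (Fin (n - r)) (Fin (n - r)) ℝ :=
  Matrix.of fun i j => V ⟨r + i.1, by omega⟩ ⟨r + j.1, by omega⟩

/-- Upper-right `r × (n-r)` block. -/
def block12 {n : ℕ} (r : ℕ) (h : r ≤ n) (V : Matrix (Fin n) (Fin n) ℝ) :
    Matrix (Fin r) (Fin (n - r)) ℝ :=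
  Matrix.of fun i j => V ⟨i.1, by omega⟩ ⟨r + j.1, by omega⟩

/-- The column space (range space) of a matrix. -/
def colSpace {p q : ℕ} (M : Matrix (Fin p) (Fin q) ℝ) : Submodule ℝ (Fin p → ℝ) :=
  LinearMap.range M.mulVecLin

/-- The "Bad condition": some linear combination `V` of the `Aᵢ` has `V₂₂ ⪰ 0`
and `ℛ(V₁₂ᵀ) ⊄ ℛ(V₂₂)`. -/
def BadCond {n m : ℕ} (A : Fin m → Matrix (Fin n) (Fin n) ℝ) (r : ℕ) (h : r ≤ n) : Prop :=
  ∃ lam : Fin m → ℝ,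
    (block22 r h (∑ i, lam i • A i)).PosSemidef ∧
    ¬ colSpace (block12 r h (∑ i, lam i • A i))ᵀ ≤
        colSpace (block22 r h (∑ i, lam i • A i))

/-- `padLow r h U = diag(0, U)` as an `n × n` matrix. -/
def padLow {n : ℕ} (r : ℕ) (h : r ≤ n) (U : Matrix (Fin (n - r)) (Fin (n - r)) ℝ) :
    Matrix (Fin n) (Fin n) ℝ :=
  Matrix.of fun a b =>
    if hab : r ≤ (a : ℕ) ∧ r ≤ (b : ℕ) then U ⟨a.1 - r, by omega⟩ ⟨b.1 - r, by omega⟩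
    else 0

/-- "Good condition 1": some positive definite `U` has `Aᵢ • diag(0, U) = 0` for all `i`. -/
def GoodCond1 {n m : ℕ} (A : Fin m → Matrix (Fin n) (Fin n) ℝ) (r : ℕ) (h : r ≤ n) : Prop :=
  ∃ U : Matrix (Fin (n - r)) (Fin (n - r)) ℝ, U.PosDef ∧ ∀ i, ip (A i) (padLow r h U) = 0

/-- "Good condition 2": every linear combination of the `Aᵢ` with zero lower-right
block has zero upper-right block. -/
def GoodCond2 {n m : ℕ} (A : Fin m → Matrix (Fin n) (Fin n) ℝ) (r : ℕ) (h : r ≤ n) : Prop :=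
  ∀ lam : Fin m → ℝ, block22 r h (∑ i, lam i • A i) = 0 →
    block12 r h (∑ i, lam i • A i) = 0

/-- `Tmat r h N = [[I_r, 0], [0, N]]`. -/
def Tmat {n : ℕ} (r : ℕ) (h : r ≤ n) (N : Matrix (Fin (n - r)) (Fin (n - r)) ℝ) :
    Matrix (Fin n) (Fin n) ℝ :=
  Matrix.of fun a b =>
    if (a : ℕ) < r ∧ (b : ℕ) < r then (if a = b then (1 : ℝ) else 0)
    else if hab : r ≤ (a : ℕ) ∧ r ≤ (b : ℕ) then N ⟨a.1 - r, by omega⟩ ⟨b.1 - r, by omega⟩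
    else 0

/-- The system `∑ xᵢ A'ᵢ ⪯ B'` is an elementary reformulation of `∑ xᵢ Aᵢ ⪯ B`:
there are an invertible `M : ℝ^{m×m}`, a vector `μ ∈ ℝ^m` and an invertible
`T = [[I_r, 0], [0, N]]` with `A'ᵢ = Tᵀ (∑ⱼ Mᵢⱼ Aⱼ) T` and `B' = Tᵀ (B + ∑ⱼ μⱼ Aⱼ) T`. -/
def ElemReform {n m : ℕ} (r : ℕ) (h : r ≤ n)
    (A : Fin m → Matrix (Fin n) (Fin n) ℝ) (B : Matrix (Fin n) (Fin n) ℝ)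
    (A' : Fin m → Matrix (Fin n) (Fin n) ℝ) (B' : Matrix (Fin n) (Fin n) ℝ) : Prop :=
  ∃ (M : Matrix (Fin m) (Fin m) ℝ) (μ : Fin m → ℝ)
    (N : Matrix (Fin (n - r)) (Fin (n - r)) ℝ),
    IsUnit M ∧ IsUnit (Tmat r h N) ∧
    (∀ i, A' i = (Tmat r h N)ᵀ * (∑ j, M i j • A j) * Tmat r h N) ∧
    B' = (Tmat r h N)ᵀ * (B + ∑ j, μ j • A j) * Tmat r h N

/-- The last `n - r` columns of a square matrix, as an `n × (n-r)` matrix. -/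
def lastCols {n : ℕ} (r : ℕ) (h : r ≤ n) (V : Matrix (Fin n) (Fin n) ℝ) :
    Matrix (Fin n) (Fin (n - r)) ℝ :=
  Matrix.of fun a j => V a ⟨r + j.1, by omega⟩

/-- Bad normal form of a semidefinite system. -/
def BadNormalForm {n m : ℕ} (A : Fin m → Matrix (Fin n) (Fin n) ℝ)
    (B : Matrix (Fin n) (Fin n) ℝ) (r : ℕ) (h : r ≤ n) : Prop :=
  B = Zmat n r ∧ MaxRankSlack A B r ∧
  ∃ k : ℕ, ∃ hk : k < m,
    (∀ i : Fin m, (i : ℕ) < k → ∀ a b : Fin n, r ≤ (b : ℕ) → A i a b = 0) ∧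
    (∀ i : Fin m, (i : ℕ) < k → ∀ a b : Fin n, r ≤ (a : ℕ) → A i a b = 0) ∧
    LinearIndependent ℝ (fun i : Fin (m - k) => lastCols r h (A ⟨k + i.1, by omega⟩)) ∧
    (block22 r h (A ⟨m - 1, by omega⟩)).PosSemidef

/-- Good normal form of a semidefinite system. -/
def GoodNormalForm {n m : ℕ} (A : Fin m → Matrix (Fin n) (Fin n) ℝ)
    (B : Matrix (Fin n) (Fin n) ℝ) (r : ℕ) (h : r ≤ n) : Prop :=
  B = Zmat n r ∧ MaxRankSlack A B r ∧
  ∃ k : ℕ, ∃ _hk : k ≤ m,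
    (∀ i : Fin m, (i : ℕ) < k → ∀ a b : Fin n,
        (r ≤ (a : ℕ) ∨ r ≤ (b : ℕ)) → A i a b = 0) ∧
    LinearIndependent ℝ (fun i : Fin (m - k) => block22 r h (A ⟨k + i.1, by omega⟩)) ∧
    ∃ U : Matrix (Fin (n - r)) (Fin (n - r)) ℝ, U.PosDef ∧
      ∀ i : Fin m, k ≤ (i : ℕ) → ip (block22 r h (A i)) U = 0

/-- The image of the positive semidefinite cone under `Y ↦ (A₁ • Y, …, A_m • Y)`. -/
def imageSet {n m : ℕ} (A : Fin m → Matrix (Fin n) (Fin n) ℝ) : Set (Fin m → ℝ) :=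
  {y | ∃ Y : Matrix (Fin n) (Fin n) ℝ, Y.PosSemidef ∧ ∀ i, ip (A i) Y = y i}

/-- The square real matrices, symmetric or not, whose quadratic form is positive definite
form an open set. -/
theorem isOpen_setOf_quadraticForm_pos (κ : Type*) [Fintype κ] :
    IsOpen {X : Matrix κ κ ℝ | ∀ v : κ → ℝ, v ≠ 0 → 0 < v ⬝ᵥ (X *ᵥ v)} := by
  have hsphere : {X : Matrix κ κ ℝ | ∀ v : κ → ℝ, v ≠ 0 → 0 < v ⬝ᵥ (X *ᵥ v)} =
      {X | ∀ v ∈ Metric.sphere (0 : κ → ℝ) 1, 0 < v ⬝ᵥ (X *ᵥ v)} := by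
    ext X
    refine ⟨fun hX v hv => hX v ?_, fun hX v hv => ?_⟩
    · rintro rfl
      simp at hv
    · have hpos : 0 < ‖v‖ := norm_pos_iff.mpr hv
      have h1 := hX (‖v‖⁻¹ • v) (by simp [norm_smul, hpos.ne'])
      rw [mulVec_smul, smul_dotProduct, dotProduct_smul, smul_eq_mul, smul_eq_mul] at h1
      exact pos_of_mul_pos_right (pos_of_mul_pos_right h1 (by positivity)) (by positivity)
  rw [hsphere, isOpen_iff_mem_nhds]
  intro X hX
  refine (isCompact_sphere (0 : κ → ℝ) 1).eventually_forall_of_forall_eventually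
    (P := fun (X : Matrix κ κ ℝ) (v : κ → ℝ) => 0 < v ⬝ᵥ (X *ᵥ v)) fun v hv => ?_
  have hcont : Continuous fun z : Matrix κ κ ℝ × (κ → ℝ) => z.2 ⬝ᵥ (z.1 *ᵥ z.2) := by
    fun_prop
  exact hcont.continuousAt.eventually (lt_mem_nhds (hX v hv))

theorem convex_setOf_quadraticForm_pos (κ : Type*) [Fintype κ] :
    Convex ℝ {X : Matrix κ κ ℝ | ∀ v : κ → ℝ, v ≠ 0 → 0 < v ⬝ᵥ (X *ᵥ v)} := by
  intro X hX Y hY a b ha hb hab v hv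
  have hXv := hX v hv
  have hYv := hY v hv
  rw [add_mulVec, smul_mulVec, smul_mulVec, dotProduct_add, dotProduct_smul, dotProduct_smul,
    smul_eq_mul, smul_eq_mul]
  rcases ha.eq_or_lt with rfl | ha
  · obtain rfl : b = 1 := by linarith
    simpa using hYv
  · exact add_pos_of_pos_of_nonneg (mul_pos ha hXv) (mul_nonneg hb hYv.le)

theorem one_quadraticForm_pos {κ : Type*} [Fintype κ] [DecidableEq κ] {v : κ → ℝ} (hv : v ≠ 0) :
    0 < v ⬝ᵥ ((1 : Matrix κ κ ℝ) *ᵥ v) := by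
  simpa using (PosDef.one (n := κ) (R := ℝ)).dotProduct_mulVec_pos hv

/-- A linear functional bounded below on a subspace vanishes on it. -/
theorem LinearMap.apply_eq_zero_of_forall_le {E : Type*} [AddCommGroup E] [Module ℝ E]
    (f : E →ₗ[ℝ] ℝ) (p : Submodule ℝ E) {u : ℝ} (hu : ∀ x ∈ p, u ≤ f x) {x : E} (hx : x ∈ p) :
    f x = 0 := by
  by_contra hne
  have := hu (((u - 1) / f x) • x) (p.smul_mem _ hx)
  rw [map_smul, smul_eq_mul, div_mul_cancel₀ _ hne] at this
  linarith

/-- A theorem of the alternative: symmetric matrices with no common positive definite orthogonal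
matrix have a positive semidefinite linear combination of positive trace. -/
theorem exists_posSemidef_sum_smul_of_not_exists_posDef {κ ι : Type*} [Fintype κ] [DecidableEq κ]
    [Fintype ι] (C : ι → Matrix κ κ ℝ) (hC : ∀ i, (C i).IsSymm)
    (hno : ¬ ∃ U : Matrix κ κ ℝ, U.PosDef ∧ ∀ i, (C i * U).trace = 0) :
    ∃ lam : ι → ℝ, (∑ i, lam i • C i).PosSemidef ∧ 0 < (∑ i, lam i • C i).trace := by
  let L : ι → Matrix κ κ ℝ →ₗ[ℝ] ℝ := fun i =>
    traceLinearMap κ ℝ ℝ ∘ₗ LinearMap.mulLeft ℝ (C i)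
  have hL : ∀ i U, L i U = (C i * U).trace := fun i U => rfl
  let p : Submodule ℝ (Matrix κ κ ℝ) := ⨅ i, LinearMap.ker (L i)
  have hp : ∀ U, U ∈ p ↔ ∀ i, (C i * U).trace = 0 := fun U => by
    simp [p, Submodule.mem_iInf, hL]
  have hdisj : Disjoint {X : Matrix κ κ ℝ | ∀ v : κ → ℝ, v ≠ 0 → 0 < v ⬝ᵥ (X *ᵥ v)}
      (p : Set (Matrix κ κ ℝ)) := by
    refine Set.disjoint_left.mpr fun X hX hXp => hno ⟨X + Xᵀ, ?_, fun i => ?_⟩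
    · refine .of_dotProduct_mulVec_pos ?_ fun v hv => ?_
      · simp [IsHermitian, conjTranspose_eq_transpose_of_trivial, add_comm]
      · have h1 := hX v hv
        have h2 : v ⬝ᵥ (Xᵀ *ᵥ v) = v ⬝ᵥ (X *ᵥ v) := by
          rw [mulVec_transpose, dotProduct_comm, dotProduct_mulVec]
        rw [star_trivial, add_mulVec, dotProduct_add, h2]
        linarith
    · have h1 := (hp X).mp hXp i
      have h2 : (C i * Xᵀ).trace = (C i * X).trace := by
        rw [← trace_transpose, transpose_mul, transpose_transpose, (hC i).eq, trace_mul_comm]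
      rw [mul_add, trace_add, h2, h1, add_zero]
  obtain ⟨f, u, hfs, hfp⟩ := geometric_hahn_banach_open (convex_setOf_quadraticForm_pos κ)
    (isOpen_setOf_quadraticForm_pos κ) p.convex hdisj
  have hfp0 : p ≤ LinearMap.ker (f : Matrix κ κ ℝ →ₗ[ℝ] ℝ) := fun X hX =>
    LinearMap.apply_eq_zero_of_forall_le (f : Matrix κ κ ℝ →ₗ[ℝ] ℝ) p hfp hX
  have hu : u ≤ 0 := by simpa using hfp 0 p.zero_mem
  obtain ⟨c, hc⟩ := (Submodule.mem_span_range_iff_exists_fun ℝ).mp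
    (mem_span_of_iInf_ker_le_ker hfp0)
  have hf : ∀ U, f U = -((∑ i, (-c i) • C i) * U).trace := fun U => by
    have := LinearMap.congr_fun hc U
    simp only [LinearMap.sum_apply, LinearMap.smul_apply, hL, smul_eq_mul] at this
    rw [ContinuousLinearMap.coe_coe] at this
    rw [← this]
    simp [Finset.sum_mul, trace_sum]
  set W := ∑ i, (-c i) • C i with hW
  have hpos : ∀ U : Matrix κ κ ℝ, (∀ v : κ → ℝ, v ≠ 0 → 0 < v ⬝ᵥ (U *ᵥ v)) →
      0 < (W * U).trace := fun U hU => by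
    have := hfs U hU
    rw [hf] at this
    linarith
  have htr : 0 < W.trace := by
    simpa using hpos 1 fun v hv => one_quadraticForm_pos hv
  refine ⟨fun i => -c i, .of_dotProduct_mulVec_nonneg ?_ fun v => ?_, htr⟩
  · rw [IsHermitian, conjTranspose_eq_transpose_of_trivial, transpose_sum]
    exact Finset.sum_congr rfl fun i _ => by rw [transpose_smul, (hC i).eq]
  · rw [star_trivial]
    refine le_of_forall_pos_lt_add' fun ε hε => ?_
    have h1 := hpos (vecMulVec v v + (ε / W.trace) • 1) fun w hw => by
      rw [add_mulVec, dotProduct_add, smul_mulVec, dotProduct_smul, vecMulVec_mulVec,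
        smul_eq_mul]
      refine add_pos_of_nonneg_of_pos ?_ (mul_pos (div_pos hε htr) (one_quadraticForm_pos hw))
      rw [op_smul_eq_smul, dotProduct_smul, smul_eq_mul, dotProduct_comm w v]
      exact mul_self_nonneg _
    rw [mul_add, trace_add, mul_vecMulVec, trace_vecMulVec, Matrix.mul_smul, mul_one, trace_smul,
      smul_eq_mul, div_mul_cancel₀ _ htr.ne', dotProduct_comm] at h1
    linarith

/-- A matrix whose range contains the columns of `Y` is a left factor of `Y`. -/
theorem exists_eq_mul_of_range_mulVecLin_le {p q s : Type*} [Fintype q] [Fintype s]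
    [DecidableEq s] (W : Matrix p q ℝ) (Y : Matrix p s ℝ)
    (hle : LinearMap.range Y.mulVecLin ≤ LinearMap.range W.mulVecLin) :
    ∃ D : Matrix q s ℝ, Y = W * D := by
  choose d hd using fun j : s => hle ⟨Pi.single j 1, rfl⟩
  refine ⟨of fun i j => d j i, ?_⟩
  ext i j
  have := congrFun (hd j) i
  simp only [mulVecLin_apply, mulVec_single_one, col_apply] at this
  rw [← this]
  rfl

/-- Moving from `diag(1, 0)` a little in the direction of a symmetric block matrix whose
lower-right block `W` is positive semidefinite of positive trace and whose lower-left block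
factors through `W` keeps the matrix positive semidefinite and increases its rank. -/
theorem exists_posSemidef_lt_rank_fromBlocks {ρ κ : Type*} [Fintype ρ] [DecidableEq ρ]
    [Fintype κ] [DecidableEq κ] (P : Matrix ρ ρ ℝ) (W : Matrix κ κ ℝ) (D : Matrix κ ρ ℝ)
    (hP : P.IsSymm) (hW : W.PosSemidef) (htr : 0 < W.trace) :
    ∃ t : ℝ, (fromBlocks 1 0 0 0 + t • fromBlocks P (W * D)ᵀ (W * D) W).PosSemidef ∧
      Fintype.card ρ < (fromBlocks 1 0 0 0 + t • fromBlocks P (W * D)ᵀ (W * D) W).rank := by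
  have hWs : Wᵀ = W := by simpa [IsHermitian] using hW.1
  let S : ℝ → Matrix ρ ρ ℝ := fun t => 1 + t • (P - Dᵀ * W * D)
  have hcont : Continuous S := by fun_prop
  obtain ⟨t, htS, ht⟩ : ∃ t : ℝ, (∀ v : ρ → ℝ, v ≠ 0 → 0 < v ⬝ᵥ (S t *ᵥ v)) ∧ 0 < t := by
    have h0 : S 0 ∈ {X : Matrix ρ ρ ℝ | ∀ v : ρ → ℝ, v ≠ 0 → 0 < v ⬝ᵥ (X *ᵥ v)} := by
      intro v hv
      simpa [S] using one_quadraticForm_pos hv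
    have hev := hcont.continuousAt.eventually
      ((isOpen_setOf_quadraticForm_pos ρ).mem_nhds h0)
    exact ((hev.filter_mono nhdsWithin_le_nhds).and
      (self_mem_nhdsWithin (s := Set.Ioi (0 : ℝ)))).exists
  have hS : (S t).PosDef := by
    refine .of_dotProduct_mulVec_pos ?_ fun v hv => by simpa using htS v hv
    simp [S, IsHermitian, conjTranspose_eq_transpose_of_trivial, transpose_mul, hP.eq, hWs,
      Matrix.mul_assoc]
  let Q : Matrix (ρ ⊕ κ) (ρ ⊕ κ) ℝ := fromBlocks 1 0 D 1
  have hQ : IsUnit Q.det := by simp [Q]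
  let N : Matrix (ρ ⊕ κ) (ρ ⊕ κ) ℝ := fromBlocks (S t) 0 0 (t • W)
  have heq : fromBlocks 1 0 0 0 + t • fromBlocks P (W * D)ᵀ (W * D) W = Qᴴ * N * Q := by
    simp [Q, N, S, conjTranspose_eq_transpose_of_trivial, fromBlocks_transpose,
      fromBlocks_multiply, fromBlocks_smul, fromBlocks_add, transpose_mul, hWs,
      Matrix.mul_assoc, smul_sub, add_assoc]
  have hN : N.PosSemidef := by
    have := hS.isUnit.invertible
    have h := (hS.fromBlocks₁₁ (0 : Matrix ρ κ ℝ) (t • W)).mpr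
      (by simpa using hW.smul ht.le)
    simpa [N] using h
  refine ⟨t, heq ▸ hN.conjTranspose_mul_mul_same Q, ?_⟩
  rw [heq, rank_mul_eq_left_of_isUnit_det _ _ hQ,
    rank_mul_eq_right_of_isUnit_det _ _ (by simpa [det_conjTranspose] using hQ)]
  obtain ⟨k, -, hk⟩ := Finset.exists_lt_of_sum_lt (s := Finset.univ) (f := fun _ : κ => (0 : ℝ))
    (g := fun i => W i i) (by simpa [trace] using htr)
  let g : ρ ⊕ Unit → ρ ⊕ κ := Sum.map id fun _ => k
  have hsub : N.submatrix g g = fromBlocks (S t) 0 0 (of fun _ _ => t * W k k) := by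
    ext (i | i) (j | j) <;> simp [N, g]
  have hdet : (N.submatrix g g).det ≠ 0 := by
    rw [hsub, det_fromBlocks_zero₂₁]
    refine mul_ne_zero hS.det_pos.ne' ?_
    simpa using ⟨ht.ne', hk.ne'⟩
  have := rank_submatrix_le N g g
  rw [rank_of_det_ne_zero hdet] at this
  rw [Fintype.card_sum, Fintype.card_unit] at this
  omega

/-- The splitting of `Fin n` into its first `r` and its last `n - r` elements. -/
def splitEquiv {n : ℕ} (r : ℕ) (h : r ≤ n) : Fin r ⊕ Fin (n - r) ≃ Fin n :=
  finSumFinEquiv.trans (finCongr (by omega))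

theorem splitEquiv_inl {n r : ℕ} (h : r ≤ n) (i : Fin r) :
    splitEquiv r h (Sum.inl i) = ⟨i.1, by omega⟩ := rfl

theorem splitEquiv_inr {n r : ℕ} (h : r ≤ n) (i : Fin (n - r)) :
    splitEquiv r h (Sum.inr i) = ⟨r + i.1, by omega⟩ := rfl

theorem submatrix_splitEquiv_of_isSymm {n r : ℕ} (h : r ≤ n) {V : Matrix (Fin n) (Fin n) ℝ}
    (hV : V.IsSymm) :
    V.submatrix (splitEquiv r h) (splitEquiv r h) =
      fromBlocks (V.submatrix (splitEquiv r h ∘ Sum.inl) (splitEquiv r h ∘ Sum.inl))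
        (block12 r h V) (block12 r h V)ᵀ (block22 r h V) := by
  ext (i | i) (j | j)
  · rfl
  · rfl
  · exact hV.apply _ _
  · rfl

theorem Zmat_submatrix_splitEquiv {n r : ℕ} (h : r ≤ n) :
    (Zmat n r).submatrix (splitEquiv r h) (splitEquiv r h) = fromBlocks 1 0 0 0 := by
  ext (i | i) (j | j) <;>
    simp [Zmat, splitEquiv_inl, splitEquiv_inr, one_apply, Fin.ext_iff]
  omega

theorem padLow_submatrix_splitEquiv {n r : ℕ} (h : r ≤ n)
    (U : Matrix (Fin (n - r)) (Fin (n - r)) ℝ) :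
    (padLow r h U).submatrix (splitEquiv r h) (splitEquiv r h) = fromBlocks 0 0 0 U := by
  ext (i | i) (j | j) <;> simp [padLow, splitEquiv_inl, splitEquiv_inr]

theorem ip_padLow {n r : ℕ} (h : r ≤ n) {V : Matrix (Fin n) (Fin n) ℝ} (hV : V.IsSymm)
    (U : Matrix (Fin (n - r)) (Fin (n - r)) ℝ) :
    ip V (padLow r h U) = (block22 r h V * U).trace := by
  have htr : ∀ M : Matrix (Fin n) (Fin n) ℝ,
      (M.submatrix (splitEquiv r h) (splitEquiv r h)).trace = M.trace := fun M =>
    (splitEquiv r h).sum_comp fun i => M i i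
  rw [ip, ← htr, ← submatrix_mul_equiv V (padLow r h U) _ (splitEquiv r h),
    submatrix_splitEquiv_of_isSymm h hV, padLow_submatrix_splitEquiv, fromBlocks_multiply]
  simp [trace, Fintype.sum_sum_type]

theorem block22_sum_smul {n m r : ℕ} (h : r ≤ n) (A : Fin m → Matrix (Fin n) (Fin n) ℝ)
    (lam : Fin m → ℝ) :
    block22 r h (∑ i, lam i • A i) = ∑ i, lam i • block22 r h (A i) := by
  ext a b
  simp [block22, Matrix.sum_apply]

theorem isSymm_sum_smul {n m : ℕ} {A : Fin m → Matrix (Fin n) (Fin n) ℝ}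
    (hA : ∀ i, (A i).IsSymm) (lam : Fin m → ℝ) : (∑ i, lam i • A i).IsSymm := by
  rw [IsSymm, transpose_sum]
  exact Finset.sum_congr rfl fun i _ => by rw [transpose_smul, (hA i).eq]

theorem badCond_of_not_goodCond1 {n m : ℕ} (A : Fin m → Matrix (Fin n) (Fin n) ℝ)
    (B : Matrix (Fin n) (Fin n) ℝ) (hA : ∀ i, (A i).IsSymm) (r : ℕ) (hr : r ≤ n)
    (hZ : MaxRankSlack A B r) (h : ¬ GoodCond1 A r hr) : BadCond A r hr := by
  have hsymm : ∀ i, (block22 r hr (A i)).IsSymm := fun i => by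
    ext a b
    exact (hA i).apply _ _
  obtain ⟨lam, hpsd, htr⟩ := exists_posSemidef_sum_smul_of_not_exists_posDef
    (fun i => block22 r hr (A i)) hsymm fun ⟨U, hU, hAU⟩ =>
      h ⟨U, hU, fun i => by rw [ip_padLow hr (hA i), hAU i]⟩
  rw [← block22_sum_smul] at hpsd htr
  have hV := isSymm_sum_smul hA lam
  refine ⟨lam, hpsd, fun hle => ?_⟩
  obtain ⟨D, hD⟩ := exists_eq_mul_of_range_mulVecLin_le _ _ hle
  have hblocks := submatrix_splitEquiv_of_isSymm hr hV
  obtain ⟨t, htpsd, htrank⟩ := exists_posSemidef_lt_rank_fromBlocks _ _ D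
    (hV.submatrix (splitEquiv r hr ∘ Sum.inl)) hpsd htr
  have hadd : ∀ M N : Matrix (Fin n) (Fin n) ℝ,
      M.submatrix (splitEquiv r hr) (splitEquiv r hr) +
        t • N.submatrix (splitEquiv r hr) (splitEquiv r hr) =
      (M + t • N).submatrix (splitEquiv r hr) (splitEquiv r hr) := fun _ _ => rfl
  rw [← hD, transpose_transpose, ← hblocks, ← Zmat_submatrix_splitEquiv hr, hadd] at htpsd htrank
  obtain ⟨⟨x, hx⟩, hmax⟩ := hZ
  have hslack : B - ∑ i, (x i - t * lam i) • A i = Zmat n r + t • ∑ i, lam i • A i := by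
    rw [← hx, Finset.smul_sum]
    simp only [sub_smul, Finset.sum_sub_distrib, mul_smul]
    abel
  have hrank := hmax (fun i => x i - t * lam i)
    (by rw [IsFeasible, hslack]; exact (posSemidef_submatrix_equiv _).mp htpsd)
  rw [rank_submatrix, Fintype.card_fin] at htrank
  rw [hslack] at hrank
  omega

theorem badCond_of_not_goodCond2 {n m : ℕ} (A : Fin m → Matrix (Fin n) (Fin n) ℝ) (r : ℕ)
    (hr : r ≤ n) (h : ¬ GoodCond2 A r hr) : BadCond A r hr := by
  simp only [GoodCond2, not_forall] at h
  obtain ⟨lam, h22, h12⟩ := h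
  refine ⟨lam, h22 ▸ .zero, fun hle => h12 ?_⟩
  obtain ⟨D, hD⟩ := exists_eq_mul_of_range_mulVecLin_le _ _ hle
  rw [h22, Matrix.zero_mul] at hD
  exact transpose_eq_zero.mp hD

/-- Under the maximum rank slack assumption, if either Good
condition fails then the Bad condition holds. -/
theorem stmt10 {n m : ℕ} (hn : 0 < n) (hm : 0 < m)
    (A : Fin m → Matrix (Fin n) (Fin n) ℝ) (B : Matrix (Fin n) (Fin n) ℝ)
    (hA : ∀ i, (A i).IsSymm) (hB : B.IsSymm)
    (hfeas : ∃ x : Fin m → ℝ, IsFeasible A B x)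
    (r : ℕ) (hr : r ≤ n) (hZ : MaxRankSlack A B r)
    (h : ¬ GoodCond1 A r hr ∨ ¬ GoodCond2 A r hr) :
    BadCond A r hr := by
  exact h.elim (badCond_of_not_goodCond1 A B hA r hr hZ) (badCond_of_not_goodCond2 A r hr)
end

section
/- Let the semidefinite system (P'_SD): Σ x_i A'_i ⪯ B' be an elementary reformulation of the feasible semidefinite system (P_SD): Σ x_i A_i ⪯ B. Then (P'_SD) is feasible, and (P_SD) is badly behaved if and only if (P'_SD) is badly behaved. -/
open Matrix

/-- `∑ xᵢ A'ᵢ ⪯ B'` arises from `∑ xᵢ Aᵢ ⪯ B` by an invertible change of the `Aᵢ`, a translation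
of the variables and a congruence by an arbitrary invertible matrix. -/
def CongruenceReform {n m : ℕ} (A : Fin m → Matrix (Fin n) (Fin n) ℝ)
    (B : Matrix (Fin n) (Fin n) ℝ) (A' : Fin m → Matrix (Fin n) (Fin n) ℝ)
    (B' : Matrix (Fin n) (Fin n) ℝ) (M : Matrix (Fin m) (Fin m) ℝ) (μ : Fin m → ℝ)
    (T : Matrix (Fin n) (Fin n) ℝ) : Prop :=
  IsUnit M ∧ IsUnit T ∧ (∀ i, A' i = Tᵀ * (∑ j, M i j • A j) * T) ∧
    B' = Tᵀ * (B + ∑ j, μ j • A j) * T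

theorem sum_smul_congr {n m : ℕ} (A : Fin m → Matrix (Fin n) (Fin n) ℝ)
    (M : Matrix (Fin m) (Fin m) ℝ) (T : Matrix (Fin n) (Fin n) ℝ) (x : Fin m → ℝ) :
    ∑ i, x i • (Tᵀ * (∑ j, M i j • A j) * T) = Tᵀ * (∑ j, (x ᵥ* M) j • A j) * T := by
  have h : ∑ j, (x ᵥ* M) j • A j = ∑ i, x i • ∑ j, M i j • A j := by
    simp only [Matrix.vecMul, dotProduct, Finset.sum_smul, Finset.smul_sum, smul_smul]
    exact Finset.sum_comm
  rw [h, Finset.mul_sum, Finset.sum_mul]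
  simp only [Matrix.mul_smul, Matrix.smul_mul]

theorem ip_congr {n : ℕ} (S T Y : Matrix (Fin n) (Fin n) ℝ) :
    ip (Tᵀ * S * T) Y = ip S (T * Y * Tᵀ) := by
  unfold ip
  rw [Matrix.mul_assoc, Matrix.mul_assoc, Matrix.trace_mul_comm]
  simp only [Matrix.mul_assoc]

theorem ip_sum_smul {n m : ℕ} (A : Fin m → Matrix (Fin n) (Fin n) ℝ) (x : Fin m → ℝ)
    (Y : Matrix (Fin n) (Fin n) ℝ) : ip (∑ j, x j • A j) Y = ∑ j, x j * ip (A j) Y := by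
  simp [ip, Finset.sum_mul, Matrix.trace_sum]

namespace CongruenceReform

variable {n m : ℕ} {A A' : Fin m → Matrix (Fin n) (Fin n) ℝ} {B B' : Matrix (Fin n) (Fin n) ℝ}
  {M : Matrix (Fin m) (Fin m) ℝ} {μ : Fin m → ℝ} {T : Matrix (Fin n) (Fin n) ℝ}

theorem symm (h : CongruenceReform A B A' B' M μ T) :
    CongruenceReform A' B' A B M⁻¹ (-(μ ᵥ* M⁻¹)) T⁻¹ := by
  obtain ⟨hM, hT, hA, hB⟩ := h
  have hMd := (Matrix.isUnit_iff_isUnit_det M).1 hM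
  have hTd := (Matrix.isUnit_iff_isUnit_det T).1 hT
  have hTt : (T⁻¹)ᵀ * Tᵀ = 1 := by
    rw [← Matrix.transpose_mul, Matrix.mul_nonsing_inv _ hTd, Matrix.transpose_one]
  have cancel (S : Matrix (Fin n) (Fin n) ℝ) : (T⁻¹)ᵀ * (Tᵀ * S * T) * T⁻¹ = S := by
    calc _ = ((T⁻¹)ᵀ * Tᵀ) * S * (T * T⁻¹) := by simp only [Matrix.mul_assoc]
      _ = S := by rw [hTt, Matrix.mul_nonsing_inv _ hTd, Matrix.one_mul, Matrix.mul_one]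
  have comb (y : Fin m → ℝ) :
      ∑ j, y j • A' j = Tᵀ * (∑ j, (y ᵥ* M) j • A j) * T := by
    simp only [hA]
    exact sum_smul_congr A M T y
  refine ⟨(Matrix.isUnit_nonsing_inv_iff).2 hM, (Matrix.isUnit_nonsing_inv_iff).2 hT, ?_, ?_⟩
  · intro i
    have hi : M⁻¹ i ᵥ* M = (1 : Matrix (Fin m) (Fin m) ℝ) i := by
      rw [← Matrix.nonsing_inv_mul M hMd]; rfl
    rw [comb, cancel, hi]
    simp [Matrix.one_apply]
  · rw [comb, hB, ← Matrix.add_mul, ← Matrix.mul_add, cancel, Matrix.neg_vecMul,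
      Matrix.vecMul_vecMul, Matrix.nonsing_inv_mul M hMd, Matrix.vecMul_one]
    simp

theorem slack_eq (h : CongruenceReform A B A' B' M μ T) (x : Fin m → ℝ) :
    B' - ∑ i, x i • A' i = Tᵀ * (B - ∑ i, (x ᵥ* M - μ) i • A i) * T := by
  obtain ⟨-, -, hA, hB⟩ := h
  simp only [hA]
  rw [sum_smul_congr, hB, ← Matrix.sub_mul, ← Matrix.mul_sub]
  simp only [Pi.sub_apply, sub_smul, Finset.sum_sub_distrib]
  congr 2
  abel

theorem isFeasible_iff (h : CongruenceReform A B A' B' M μ T) (x : Fin m → ℝ) :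
    IsFeasible A' B' x ↔ IsFeasible A B (x ᵥ* M - μ) := by
  unfold IsFeasible
  rw [h.slack_eq, ← Matrix.conjTranspose_eq_transpose_of_trivial]
  exact h.2.1.posSemidef_star_left_conjugate_iff

theorem exists_preimage (h : CongruenceReform A B A' B' M μ T) (x : Fin m → ℝ) :
    ∃ y : Fin m → ℝ, y ᵥ* M - μ = x := by
  refine ⟨(x + μ) ᵥ* M⁻¹, ?_⟩
  rw [Matrix.vecMul_vecMul, Matrix.nonsing_inv_mul M ((Matrix.isUnit_iff_isUnit_det M).1 h.1)]
  simp

theorem exists_isFeasible (h : CongruenceReform A B A' B' M μ T)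
    (hf : ∃ x : Fin m → ℝ, IsFeasible A B x) : ∃ x : Fin m → ℝ, IsFeasible A' B' x := by
  obtain ⟨x, hx⟩ := hf
  obtain ⟨y, rfl⟩ := h.exists_preimage x
  exact ⟨y, (h.isFeasible_iff y).2 hx⟩

theorem primalVals_eq (h : CongruenceReform A B A' B' M μ T) (c : Fin m → ℝ) :
    PrimalVals A' B' (M *ᵥ c) = OrderIso.addRight (c ⬝ᵥ μ) '' PrimalVals A B c := by
  have obj (y : Fin m → ℝ) : (M *ᵥ c) ⬝ᵥ y = c ⬝ᵥ (y ᵥ* M - μ) + c ⬝ᵥ μ := by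
    rw [dotProduct_sub, sub_add_cancel, dotProduct_comm, Matrix.dotProduct_mulVec,
      dotProduct_comm]
  ext s
  constructor
  · rintro ⟨y, hy, rfl⟩
    exact ⟨_, ⟨_, (h.isFeasible_iff y).1 hy, rfl⟩, (obj y).symm⟩
  · rintro ⟨_, ⟨x, hx, rfl⟩, rfl⟩
    obtain ⟨y, rfl⟩ := h.exists_preimage x
    exact ⟨y, (h.isFeasible_iff y).2 hx, (obj y).symm⟩

theorem badlyBehaved (h : CongruenceReform A B A' B' M μ T) (hbad : BadlyBehaved A B) :
    BadlyBehaved A' B' := by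
  obtain ⟨c, v, hv, hY⟩ := hbad
  refine ⟨M *ᵥ c, v + c ⬝ᵥ μ, ?_, ?_⟩
  · rw [h.primalVals_eq]
    exact (OrderIso.addRight (c ⬝ᵥ μ)).isLUB_image'.2 hv
  · rintro ⟨Y, hpsd, hAY, hBY⟩
    obtain ⟨hM, -, hA, hB⟩ := h
    have hdual : (fun j => ip (A j) (T * Y * Tᵀ)) = c := by
      apply Matrix.mulVec_injective_of_isUnit hM
      funext i
      rw [← hAY i, hA, ip_congr, ip_sum_smul]
      rfl
    refine hY ⟨T * Y * Tᵀ, ?_, fun i => congrFun hdual i, ?_⟩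
    · rw [← Matrix.conjTranspose_eq_transpose_of_trivial]
      exact hpsd.mul_mul_conjTranspose_same T
    · have hsplit : ip (B + ∑ j, μ j • A j) (T * Y * Tᵀ)
          = ip B (T * Y * Tᵀ) + ip (∑ j, μ j • A j) (T * Y * Tᵀ) := by
        simp only [ip, Matrix.add_mul, Matrix.trace_add]
      have hμ : ∑ j, μ j * ip (A j) (T * Y * Tᵀ) = c ⬝ᵥ μ := by
        rw [dotProduct_comm, ← hdual]
        rfl
      rw [hB, ip_congr, hsplit, ip_sum_smul, hμ] at hBY
      exact add_right_cancel hBY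

end CongruenceReform

/-- An elementary reformulation of a feasible system is feasible,
and it is badly behaved iff the original system is. -/
theorem stmt11 {n m : ℕ} (hn : 0 < n) (hm : 0 < m)
    (A A' : Fin m → Matrix (Fin n) (Fin n) ℝ) (B B' : Matrix (Fin n) (Fin n) ℝ)
    (hA : ∀ i, (A i).IsSymm) (hB : B.IsSymm)
    (r : ℕ) (hr : r ≤ n)
    (href : ElemReform r hr A B A' B')
    (hfeas : ∃ x : Fin m → ℝ, IsFeasible A B x) :
    (∃ x : Fin m → ℝ, IsFeasible A' B' x) ∧
      (BadlyBehaved A B ↔ BadlyBehaved A' B') := by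
  obtain ⟨M, μ, N, hM, hT, hA', hB'⟩ := href
  have h : CongruenceReform A B A' B' M μ (Tmat r hr N) := ⟨hM, hT, hA', hB'⟩
  exact ⟨h.exists_isFeasible hfeas, h.badlyBehaved, h.symm.badlyBehaved⟩
end

section
/- Let Z = diag(I_r, 0) be a maximum rank slack of the feasible semidefinite system (P_SD) (Z is a slack and every slack has rank at most r), and let (P'_SD): Σ x_i A'_i ⪯ B' be an elementary reformulation of (P_SD) whose congruence matrix T has the block form T = [[I_r, 0],[0, N]]. Then Z is also a maximum rank slack of (P'_SD). -/
open Matrix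

theorem transpose_Zmat (n r : ℕ) : (Zmat n r)ᵀ = Zmat n r := by
  ext i j
  simp only [Zmat, transpose_apply, of_apply]
  by_cases hij : i = j
  · simp [hij]
  · simp [hij, Ne.symm hij]

theorem Zmat_mul_Tmat {n : ℕ} (r : ℕ) (h : r ≤ n) (N : Matrix (Fin (n - r)) (Fin (n - r)) ℝ) :
    Zmat n r * Tmat r h N = Zmat n r := by
  ext i j
  rw [mul_apply, Finset.sum_eq_single i]
  · by_cases hi : (i : ℕ) < r
    · by_cases hj : (j : ℕ) < r
      · simp [Zmat, Tmat, hi, hj]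
      · have hij : i ≠ j := by rintro rfl; exact hj hi
        simp [Zmat, Tmat, hi, hj, hij]
    · simp [Zmat, hi]
  · intro k _ hk
    simp [Zmat, hk.symm]
  · simp

theorem Tmat_transpose_mul_Zmat_mul_Tmat {n : ℕ} (r : ℕ) (h : r ≤ n)
    (N : Matrix (Fin (n - r)) (Fin (n - r)) ℝ) :
    (Tmat r h N)ᵀ * Zmat n r * Tmat r h N = Zmat n r := by
  rw [Matrix.mul_assoc, Zmat_mul_Tmat, ← transpose_Zmat, ← transpose_mul, Zmat_mul_Tmat]

/-- A slack of a reformulated system is congruent to a slack of the original one. -/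
theorem slack_reformulation {n m : ℕ} (A : Fin m → Matrix (Fin n) (Fin n) ℝ)
    (B T : Matrix (Fin n) (Fin n) ℝ) (M : Matrix (Fin m) (Fin m) ℝ) (μ x : Fin m → ℝ) :
    Tᵀ * (B + ∑ j, μ j • A j) * T - ∑ i, x i • (Tᵀ * (∑ j, M i j • A j) * T) =
      Tᵀ * (B - ∑ j, (x ᵥ* M - μ) j • A j) * T := by
  have hsum : ∑ i, x i • (Tᵀ * (∑ j, M i j • A j) * T) =
      Tᵀ * (∑ j, (x ᵥ* M) j • A j) * T := by
    have hcomb : ∑ j, (x ᵥ* M) j • A j = ∑ i, x i • ∑ j, M i j • A j := by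
      simp only [vecMul, dotProduct, Finset.sum_smul, Finset.smul_sum, smul_smul]
      exact Finset.sum_comm
    rw [hcomb, Matrix.mul_sum, Matrix.sum_mul]
    simp only [Matrix.mul_smul, Matrix.smul_mul]
  rw [hsum, ← Matrix.sub_mul, ← Matrix.mul_sub]
  congr 2
  simp only [Pi.sub_apply, sub_smul, Finset.sum_sub_distrib]
  abel

/-- If `Z = diag(I_r, 0)` is a maximum rank slack of the feasible
system, then it is also a maximum rank slack of any elementary reformulation
whose congruence matrix has the block form `[[I_r, 0], [0, N]]`. -/
theorem stmt12 {n m : ℕ} (hn : 0 < n) (hm : 0 < m)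
    (A A' : Fin m → Matrix (Fin n) (Fin n) ℝ) (B B' : Matrix (Fin n) (Fin n) ℝ)
    (hA : ∀ i, (A i).IsSymm) (hB : B.IsSymm)
    (hfeas : ∃ x : Fin m → ℝ, IsFeasible A B x)
    (r : ℕ) (hr : r ≤ n) (hZ : MaxRankSlack A B r)
    (href : ElemReform r hr A B A' B') :
    MaxRankSlack A' B' r := by
  obtain ⟨M, μ, N, hM, hT, hA', rfl⟩ := href
  obtain rfl : A' = _ := funext hA'
  obtain ⟨⟨y, hy⟩, hmax⟩ := hZ
  have hMdet : IsUnit M.det := (isUnit_iff_isUnit_det M).mp hM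
  refine ⟨⟨(y + μ) ᵥ* M⁻¹, ?_⟩, fun x hx => ?_⟩
  · rw [slack_reformulation, vecMul_vecMul, nonsing_inv_mul M hMdet, vecMul_one,
      add_sub_cancel_right, hy, Tmat_transpose_mul_Zmat_mul_Tmat]
  · unfold IsFeasible at hx
    rw [slack_reformulation] at hx ⊢
    rw [← conjTranspose_eq_transpose_of_trivial] at hx
    exact (rank_mul_le_left _ _).trans <| (rank_mul_le_right _ _).trans <|
      hmax _ (hT.posSemidef_star_left_conjugate_iff.mp hx)
end

section
/- Let A_1,…,A_m be real symmetric n×n matrices and let 𝒜*(Y) = (A_1•Y, …, A_m•Y). Then the set 𝒜*(PSD^n) ⊆ ℝ^m is not closed if and only if the homogeneous semidefinite system (P_SDH): Σ_{i=1}^m x_i A_i ⪯ 0 is badly behaved. -/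
open Matrix

lemma trace_mul_nonneg_of_posSemidef {ι : Type*} [Fintype ι] {S Y : Matrix ι ι ℝ}
    (hS : S.PosSemidef) (hY : Y.PosSemidef) : 0 ≤ (S * Y).trace := by
  obtain ⟨k, v, rfl⟩ := Matrix.posSemidef_iff_eq_sum_vecMulVec.mp hY
  rw [Matrix.mul_sum, Matrix.trace_sum]
  refine Finset.sum_nonneg fun i _ => ?_
  rw [Matrix.mul_vecMulVec, Matrix.trace_vecMulVec, dotProduct_comm]
  exact hS.dotProduct_mulVec_nonneg (v i)

lemma sum_ip_mul {n m : ℕ} (A : Fin m → Matrix (Fin n) (Fin n) ℝ)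
    (Y : Matrix (Fin n) (Fin n) ℝ) (x : Fin m → ℝ) :
    ∑ i, ip (A i) Y * x i = ip (∑ i, x i • A i) Y := by
  simp only [ip, Finset.sum_mul, Matrix.smul_mul, Matrix.trace_sum, Matrix.trace_smul,
    smul_eq_mul, mul_comm]

lemma ip_vecMulVec_self {n : ℕ} (M : Matrix (Fin n) (Fin n) ℝ) (v : Fin n → ℝ) :
    ip M (Matrix.vecMulVec v v) = v ⬝ᵥ (M *ᵥ v) := by
  rw [ip, Matrix.mul_vecMulVec, Matrix.trace_vecMulVec, dotProduct_comm]

lemma convex_imageSet {n m : ℕ} (A : Fin m → Matrix (Fin n) (Fin n) ℝ) :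
    Convex ℝ (imageSet A) := by
  rintro y ⟨Y, hY, hy⟩ z ⟨Z, hZ, hz⟩ a b ha hb -
  refine ⟨a • Y + b • Z, (hY.smul ha).add (hZ.smul hb), fun i => ?_⟩
  simp [ip, Matrix.mul_add, ← hy, ← hz]

lemma smul_mem_imageSet {n m : ℕ} {A : Fin m → Matrix (Fin n) (Fin n) ℝ} {y : Fin m → ℝ}
    (hy : y ∈ imageSet A) {t : ℝ} (ht : 0 ≤ t) : t • y ∈ imageSet A := by
  obtain ⟨Y, hY, hy⟩ := hy
  exact ⟨t • Y, hY.smul ht, fun i => by simp [ip, ← hy]⟩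

lemma isFeasible_zero {n m : ℕ} (A : Fin m → Matrix (Fin n) (Fin n) ℝ) :
    IsFeasible A 0 0 := by
  simp [IsFeasible, Matrix.PosSemidef.zero]

lemma IsFeasible.smul {n m : ℕ} {A : Fin m → Matrix (Fin n) (Fin n) ℝ} {x : Fin m → ℝ}
    (hx : IsFeasible A 0 x) {t : ℝ} (ht : 0 ≤ t) : IsFeasible A 0 (t • x) := by
  have h := Matrix.PosSemidef.smul hx ht
  simpa [IsFeasible, Finset.smul_sum, smul_smul] using h

/-- The closure of the image of the psd cone is the polar of the feasible set. -/
lemma mem_closure_imageSet_iff {n m : ℕ} {A : Fin m → Matrix (Fin n) (Fin n) ℝ}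
    (hA : ∀ i, (A i).IsSymm) {c : Fin m → ℝ} :
    c ∈ closure (imageSet A) ↔ ∀ x, IsFeasible A 0 x → ∑ i, c i * x i ≤ 0 := by
  constructor
  · intro hc x hx
    have hclosed : IsClosed {y : Fin m → ℝ | ∑ i, y i * x i ≤ 0} :=
      isClosed_le (by fun_prop) continuous_const
    refine closure_minimal ?_ hclosed hc
    rintro y ⟨Y, hY, hy⟩
    have h := trace_mul_nonneg_of_posSemidef hx hY
    rw [zero_sub, Matrix.neg_mul, Matrix.trace_neg] at h
    change ∑ i, y i * x i ≤ 0
    simp only [← hy]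
    rw [sum_ip_mul, ip]
    linarith
  · intro h
    by_contra hc
    obtain ⟨f, u, hf, hu⟩ :=
      geometric_hahn_banach_closed_point (convex_imageSet A).closure isClosed_closure hc
    have hzero : (0 : Fin m → ℝ) ∈ imageSet A := ⟨0, Matrix.PosSemidef.zero, by simp [ip]⟩
    have hu0 : 0 < u := by simpa using hf 0 (subset_closure hzero)
    have hf_nonpos : ∀ y ∈ imageSet A, f y ≤ 0 := by
      intro y hy
      by_contra! hpos
      have := hf _ (subset_closure (smul_mem_imageSet hy (div_nonneg hu0.le hpos.le)))
      rw [map_smul, smul_eq_mul, div_mul_cancel₀ _ hpos.ne'] at this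
      exact lt_irrefl _ this
    have hf_eq : ∀ y, f y = ∑ i, y i * f (Pi.single i 1) := by
      intro y
      conv_lhs => rw [pi_eq_sum_univ' y]
      simp
    have hfeas : IsFeasible A 0 (fun i => f (Pi.single i 1)) := by
      refine Matrix.PosSemidef.of_dotProduct_mulVec_nonneg ?_ fun v => ?_
      · simp [Matrix.IsHermitian, Matrix.conjTranspose_eq_transpose_of_trivial,
          Matrix.transpose_sum, fun i => (hA i).eq]
      · have hv := hf_nonpos (fun i => ip (A i) (Matrix.vecMulVec v v))
          ⟨_, by simpa using Matrix.posSemidef_vecMulVec_self_star v, fun _ => rfl⟩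
        rw [hf_eq, sum_ip_mul, ip_vecMulVec_self] at hv
        simpa [Matrix.neg_mulVec] using hv
    have := h _ hfeas
    rw [← hf_eq] at this
    linarith

lemma isLUB_primalVals_zero_iff {n m : ℕ} {A : Fin m → Matrix (Fin n) (Fin n) ℝ}
    {c : Fin m → ℝ} {v : ℝ} :
    IsLUB (PrimalVals A 0 c) v ↔
      v = 0 ∧ ∀ x, IsFeasible A 0 x → ∑ i, c i * x i ≤ 0 := by
  have hzero : (0 : ℝ) ∈ PrimalVals A 0 c := ⟨0, isFeasible_zero A, by simp⟩
  constructor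
  · intro hv
    have hv0 : 0 ≤ v := hv.1 hzero
    have hle : ∀ x, IsFeasible A 0 x → ∑ i, c i * x i ≤ 0 := by
      intro x hx
      by_contra! hpos
      have ht : 0 ≤ (v + 1) / ∑ i, c i * x i := by positivity
      have := hv.1 ⟨_, hx.smul ht, rfl⟩
      simp only [Pi.smul_apply, smul_eq_mul, mul_left_comm (c _)] at this
      rw [← Finset.mul_sum, div_mul_cancel₀ _ hpos.ne'] at this
      linarith
    refine ⟨le_antisymm (hv.2 ?_) hv0, hle⟩
    rintro s ⟨x, hx, rfl⟩
    exact hle x hx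
  · rintro ⟨rfl, h⟩
    refine ⟨?_, fun b hb => hb hzero⟩
    rintro s ⟨x, hx, rfl⟩
    exact h x hx

/-- The image of the psd cone under `Y ↦ (A₁ • Y, …, A_m • Y)` is
not closed iff the homogeneous system `∑ xᵢ Aᵢ ⪯ 0` is badly behaved. -/
theorem stmt13 {n m : ℕ} (hn : 0 < n) (hm : 0 < m)
    (A : Fin m → Matrix (Fin n) (Fin n) ℝ) (hA : ∀ i, (A i).IsSymm) :
    ¬ IsClosed (imageSet A) ↔ BadlyBehaved A (0 : Matrix (Fin n) (Fin n) ℝ) := by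
  simp only [BadlyBehaved, isLUB_primalVals_zero_iff, ← mem_closure_imageSet_iff hA]
  rw [← closure_subset_iff_isClosed, Set.not_subset]
  constructor
  · rintro ⟨c, hc, hc'⟩
    exact ⟨c, 0, ⟨rfl, hc⟩, fun ⟨Y, hY, hYc, _⟩ => hc' ⟨Y, hY, hYc⟩⟩
  · rintro ⟨c, v, ⟨rfl, hc⟩, hY⟩
    exact ⟨c, hc, fun ⟨Y, hYp, hYc⟩ => hY ⟨Y, hYp, hYc, by simp [ip]⟩⟩
end

section
/- Let A_1,…,A_m be real symmetric n×n matrices, 𝒜*(Y) = (A_1•Y, …, A_m•Y), c ∈ ℝ^m, and H = {Y ∈ S^n : A_i•Y = c_i for all i}. Then c lies in the frontier of 𝒜*(PSD^n) if and only if H ∩ PSD^n = ∅ and dist(H, PSD^n) = 0, where dist(S_1,S_2) = inf{‖Y_1 − Y_2‖ : Y_1 ∈ S_1, Y_2 ∈ S_2} (i.e., H is an affine asymptote of PSD^n). -/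
open Matrix

theorem ip_eq_sum {k : ℕ} (S : Matrix (Fin k) (Fin k) ℝ) {T : Matrix (Fin k) (Fin k) ℝ}
    (hT : T.IsSymm) : ip S T = ∑ p : Fin k × Fin k, S p.1 p.2 * T p.1 p.2 := by
  simp only [ip, Matrix.trace, Matrix.diag, Matrix.mul_apply, Fintype.sum_prod_type]
  exact Finset.sum_congr rfl fun i _ => Finset.sum_congr rfl fun j _ => by rw [hT.apply]

/-- Cauchy-Schwarz for the trace inner product. -/
theorem abs_ip_le {k : ℕ} {S T : Matrix (Fin k) (Fin k) ℝ} (hS : S.IsSymm) (hT : T.IsSymm) :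
    |ip S T| ≤ √(ip S S) * √(ip T T) := by
  have hnonneg : 0 ≤ ip S S := by
    rw [ip_eq_sum S hS]
    exact Finset.sum_nonneg fun p _ => mul_self_nonneg _
  rw [← Real.sqrt_mul hnonneg]
  apply Real.abs_le_sqrt
  rw [ip_eq_sum S hT, ip_eq_sum S hS, ip_eq_sum T hT]
  simpa only [pow_two] using Finset.sum_mul_sq_le_sq_mul_sq Finset.univ
    (fun p : Fin k × Fin k => S p.1 p.2) (fun p => T p.1 p.2)

theorem ip_transpose {k : ℕ} {S : Matrix (Fin k) (Fin k) ℝ} (hS : S.IsSymm)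
    (T : Matrix (Fin k) (Fin k) ℝ) : ip S Tᵀ = ip S T := by
  rw [ip, ip, ← Matrix.trace_transpose, Matrix.transpose_mul, Matrix.transpose_transpose, hS.eq,
    Matrix.trace_mul_comm]

/-- The linear map `Y ↦ (A₁ • Y, …, A_m • Y)`. -/
noncomputable def ipMap {n m : ℕ} (A : Fin m → Matrix (Fin n) (Fin n) ℝ) :
    Matrix (Fin n) (Fin n) ℝ →ₗ[ℝ] (Fin m → ℝ) where
  toFun Y i := ip (A i) Y
  map_add' X Y := by ext i; simp [ip, Matrix.mul_add]
  map_smul' r Y := by ext i; simp [ip]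

@[simp]
theorem ipMap_apply {n m : ℕ} (A : Fin m → Matrix (Fin n) (Fin n) ℝ)
    (Y : Matrix (Fin n) (Fin n) ℝ) (i : Fin m) : ipMap A Y i = ip (A i) Y := rfl

/-- `ipMap A` has a linear generalized inverse with symmetric values. -/
theorem exists_symm_generalized_inverse {n m : ℕ} {A : Fin m → Matrix (Fin n) (Fin n) ℝ}
    (hA : ∀ i, (A i).IsSymm) :
    ∃ g : (Fin m → ℝ) →ₗ[ℝ] Matrix (Fin n) (Fin n) ℝ,
      (∀ v, (g v).IsSymm) ∧ ∀ v ∈ LinearMap.range (ipMap A), ipMap A (g v) = v := by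
  obtain ⟨g₀, hg₀⟩ := (ipMap A).rangeRestrict.exists_rightInverse_of_surjective
    (LinearMap.range_rangeRestrict _)
  obtain ⟨g, hg⟩ := LinearMap.exists_extend g₀
  have hright : ∀ v ∈ LinearMap.range (ipMap A), ipMap A (g v) = v := fun v hv => by
    have h₁ : g v = g₀ ⟨v, hv⟩ := LinearMap.congr_fun hg ⟨v, hv⟩
    have h₂ := congrArg Subtype.val (LinearMap.congr_fun hg₀ ⟨v, hv⟩)
    rw [h₁]
    exact h₂
  let t : Matrix (Fin n) (Fin n) ℝ →ₗ[ℝ] Matrix (Fin n) (Fin n) ℝ :=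
    (Matrix.transposeLinearEquiv (Fin n) (Fin n) ℝ ℝ).toLinearMap
  refine ⟨(2⁻¹ : ℝ) • (g + t ∘ₗ g), fun v => ?_, fun v hv => ?_⟩
  · simp [t, Matrix.IsSymm, add_comm]
  · have ht : ipMap A (g v)ᵀ = ipMap A (g v) := by
      ext i
      exact ip_transpose (hA i) _
    have : ((2⁻¹ : ℝ) • (g + t ∘ₗ g)) v = (2⁻¹ : ℝ) • (g v + (g v)ᵀ) := rfl
    rw [this, map_smul, map_add, ht, hright v hv, ← two_smul ℝ v, smul_smul]
    norm_num

/-- `c` lies in the frontier of the image of the psd cone iff the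
affine subspace `H = {Y symmetric : Aᵢ • Y = cᵢ}` is disjoint from the psd cone
but at distance `0` from it (distance induced by the trace inner product),
i.e. `H` is an affine asymptote of the psd cone. -/
theorem stmt16 {n m : ℕ} (hn : 0 < n) (hm : 0 < m)
    (A : Fin m → Matrix (Fin n) (Fin n) ℝ) (hA : ∀ i, (A i).IsSymm)
    (c : Fin m → ℝ) :
    c ∈ closure (imageSet A) \ imageSet A ↔
      ({Y : Matrix (Fin n) (Fin n) ℝ | Y.IsSymm ∧ ∀ i, ip (A i) Y = c i} ∩
          {Y : Matrix (Fin n) (Fin n) ℝ | Y.PosSemidef} = ∅) ∧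
      IsGLB {d : ℝ |
          ∃ Y₁ ∈ {Y : Matrix (Fin n) (Fin n) ℝ | Y.IsSymm ∧ ∀ i, ip (A i) Y = c i},
          ∃ Y₂ ∈ {Y : Matrix (Fin n) (Fin n) ℝ | Y.PosSemidef},
            d = Real.sqrt (ip (Y₁ - Y₂) (Y₁ - Y₂))} 0 := by
  have hsymm : ∀ Y : Matrix (Fin n) (Fin n) ℝ, Y.PosSemidef → Y.IsSymm := fun Y hY => by
    simpa [Matrix.IsSymm, Matrix.IsHermitian, Matrix.conjTranspose_eq_transpose_of_trivial]
      using hY.isHermitian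
  have hdisj : c ∉ imageSet A ↔
      ({Y : Matrix (Fin n) (Fin n) ℝ | Y.IsSymm ∧ ∀ i, ip (A i) Y = c i} ∩
        {Y : Matrix (Fin n) (Fin n) ℝ | Y.PosSemidef} = ∅) := by
    rw [Set.eq_empty_iff_forall_notMem]
    exact ⟨fun h Y hY => h ⟨Y, hY.2, hY.1.2⟩, fun h ⟨Y, hY, hc⟩ => h Y ⟨⟨hsymm Y hY, hc⟩, hY⟩⟩
  rw [Set.mem_sdiff, and_comm, hdisj]
  refine and_congr_right fun _ => ⟨fun hc => ⟨?_, fun b hb => ?_⟩, fun hglb => ?_⟩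
  · rintro d ⟨Y₁, -, Y₂, -, rfl⟩
    exact Real.sqrt_nonneg _
  · obtain ⟨g, hgs, hg⟩ := exists_symm_generalized_inverse hA
    have hsub : imageSet A ⊆ LinearMap.range (ipMap A) := fun y ⟨Y, _, hy⟩ => ⟨Y, funext hy⟩
    have hcr : c ∈ LinearMap.range (ipMap A) :=
      closure_minimal hsub (Submodule.closed_of_finiteDimensional _) hc
    have hgc : Continuous g := g.continuous_of_finiteDimensional
    have hcont : Continuous fun y => √(ip (g (c - y)) (g (c - y))) := by
      unfold ip
      fun_prop
    have hbound : ∀ y ∈ imageSet A, b ≤ √(ip (g (c - y)) (g (c - y))) := by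
      rintro y ⟨Y, hY, hy⟩
      have hyr : y ∈ LinearMap.range (ipMap A) := ⟨Y, funext hy⟩
      refine hb ⟨Y + g (c - y), ⟨(hsymm Y hY).add (hgs _), fun i => ?_⟩, Y, hY, by simp⟩
      have h := congrFun (hg _ (Submodule.sub_mem _ hcr hyr)) i
      rw [← ipMap_apply, map_add, Pi.add_apply, h, ipMap_apply, hy]
      simp
    have h : b ≤ √(ip (g (c - c)) (g (c - c))) :=
      closure_minimal hbound (isClosed_le continuous_const hcont) hc
    simpa [ip] using h
  · rw [Metric.mem_closure_iff]
    intro ε hε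
    obtain ⟨K, hK₀, hK⟩ : ∃ K : ℝ, 0 < K ∧ ∀ i, √(ip (A i) (A i)) < K := by
      refine ⟨1 + ∑ i, √(ip (A i) (A i)), ?_, fun i => ?_⟩
      · have : 0 ≤ ∑ i, √(ip (A i) (A i)) := Finset.sum_nonneg fun i _ => Real.sqrt_nonneg _
        linarith
      · have := Finset.single_le_sum (f := fun i => √(ip (A i) (A i)))
          (fun i _ => Real.sqrt_nonneg _) (Finset.mem_univ i)
        linarith
    obtain ⟨_, ⟨Y₁, hY₁, Y₂, hY₂, rfl⟩, -, hlt⟩ := hglb.exists_between (div_pos hε hK₀)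
    refine ⟨fun i => ip (A i) Y₂, ⟨Y₂, hY₂, fun _ => rfl⟩, (dist_pi_lt_iff hε).2 fun i => ?_⟩
    have hsub : c i - ip (A i) Y₂ = ip (A i) (Y₁ - Y₂) := by
      rw [← hY₁.2 i]
      simp [ip, Matrix.mul_sub]
    rw [Real.dist_eq, hsub]
    calc |ip (A i) (Y₁ - Y₂)|
        ≤ √(ip (A i) (A i)) * √(ip (Y₁ - Y₂) (Y₁ - Y₂)) :=
          abs_ip_le (hA i) (hY₁.1.sub (hsymm Y₂ hY₂))
      _ ≤ K * √(ip (Y₁ - Y₂) (Y₁ - Y₂)) := by gcongr; exact (hK i).le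
      _ < K * (ε / K) := by gcongr
      _ = ε := by field_simp
end
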